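/- Let C : f = 0 be a reduced plane curve of degree d in P²(ℂ) and let θ ∈ D_0(f) be a nonzero derivation of degree r with 2r ≤ d − 1, such that the eigenscheme Γ_θ is 0-dimensional. Then C is a free curve with exponents (r, d−r−1) if and only if f ∈ I_θ. -/

import Mathlib

open MvPolynomial

noncomputable section

/-- `S = ℂ[x,y,z]`, with `x = X 0`, `y = X 1`, `z = X 2`. -/
abbrev S3 := MvPolynomial (Fin 3) ℂ

/-- The graded `S`-module `D_0(f)` of Jacobian syzygies of `f`. -/
def jacSyz (f : S3) : Submodule S3 (Fin 3 → S3) where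
  carrier := {v | v 0 * pderiv 0 f + v 1 * pderiv 1 f + v 2 * pderiv 2 f = 0}
  add_mem' := by
    intro a b ha hb
    simp only [Set.mem_setOf_eq, Pi.add_apply] at *
    linear_combination ha + hb
  zero_mem' := by simp
  smul_mem' := by
    intro c v hv
    simp only [Set.mem_setOf_eq, Pi.smul_apply, smul_eq_mul] at *
    linear_combination c * hv

/-- `v` is a minimal system of `m` homogeneous generators of `D_0(f)`, the generator
`v j` being a syzygy of degree `dd j`, and `dd` nondecreasing: this says that
`C : f = 0` is an `m`-syzygy curve with exponents `dd`. -/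
structure IsMinGenSyz (f : S3) (m : ℕ) (dd : Fin m → ℕ) (v : Fin m → (Fin 3 → S3)) : Prop where
  mem : ∀ j, v j ∈ jacSyz f
  hom : ∀ j i, ((v j) i).IsHomogeneous (dd j)
  ne_zero : ∀ j, v j ≠ 0
  span_eq : Submodule.span S3 (Set.range v) = jacSyz f
  minimal : ∀ j, v j ∉ Submodule.span S3 (v '' {j' | j' ≠ j})
  mono : Monotone dd

/-- `C : f = 0` is free with exponents `(d1, d2)`. -/
def IsFreeWith (f : S3) (d1 d2 : ℕ) : Prop := ∃ v, IsMinGenSyz f 2 ![d1, d2] v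

/-- `C : f = 0` is a free curve (a 2-syzygy curve). -/
def IsFreeCurve (f : S3) : Prop := ∃ d1 d2, IsFreeWith f d1 d2

/-- `C : f = 0` of degree `d` is nearly free with exponents `(d1, d2)`:
a 3-syzygy curve with exponents `(d1, d2, d2)` and `d1 + d2 = d`. -/
def IsNearlyFreeWith (f : S3) (d d1 d2 : ℕ) : Prop :=
  d1 + d2 = d ∧ ∃ v, IsMinGenSyz f 3 ![d1, d2, d2] v

/-- `C : f = 0` of degree `d` is a nearly free curve. -/
def IsNearlyFree (f : S3) (d : ℕ) : Prop := ∃ d1 d2, IsNearlyFreeWith f d d1 d2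

/-- `C : f = 0` of degree `d` is plus-one generated with exponents `(d1, d2, d3)`:
a 3-syzygy curve with `d1 + d2 = d`. -/
def IsPOGWith (f : S3) (d d1 d2 d3 : ℕ) : Prop :=
  d1 + d2 = d ∧ ∃ v, IsMinGenSyz f 3 ![d1, d2, d3] v

/-- `C : f = 0` of degree `d` is a plus-one generated curve. -/
def IsPOG (f : S3) (d : ℕ) : Prop := ∃ d1 d2 d3, IsPOGWith f d d1 d2 d3

/-- `C : f = 0` of degree `d` is minimal plus-one generated (MPOG),
with exponents `(d1, d2, d2 + 1)`. -/
def IsMPOGWith (f : S3) (d d1 d2 : ℕ) : Prop := IsPOGWith f d d1 d2 (d2 + 1)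

/-- `C : f = 0` of degree `d` is an MPOG-curve. -/
def IsMPOG (f : S3) (d : ℕ) : Prop := ∃ d1 d2, IsMPOGWith f d d1 d2

/-- `r = mdr(f)`: the minimal degree of a nonzero (homogeneous) Jacobian relation for `f`. -/
def IsMDR (f : S3) (r : ℕ) : Prop :=
  (∃ v ∈ jacSyz f, v ≠ 0 ∧ ∀ i, (v i).IsHomogeneous r) ∧
  ∀ m, m < r → ∀ v ∈ jacSyz f, (∀ i, (v i).IsHomogeneous m) → v = 0

/-- The Jacobian ideal `J_f` of `f`. -/
def jacobianIdeal (f : S3) : Ideal S3 := Ideal.span {pderiv 0 f, pderiv 1 f, pderiv 2 f}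

/-- The dimension of the degree `k` graded piece of the Milnor algebra `M(f) = S/J_f`. -/
def milnorDim (f : S3) (k : ℕ) : ℕ :=
  Module.finrank ℂ
    (↥(homogeneousSubmodule (Fin 3) ℂ k) ⧸
      (Submodule.comap (homogeneousSubmodule (Fin 3) ℂ k).subtype
        (Submodule.restrictScalars ℂ (jacobianIdeal f))))

/-- `τ` is the total Tjurina number of the reduced curve `C : f = 0`, i.e. the degree of the
Jacobian ideal `J_f`: for all large `k` one has `dim M(f)_k = τ`. -/
def IsTjurina (f : S3) (τ : ℕ) : Prop := ∀ᶠ k in Filter.atTop, milnorDim f k = τ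

/-- `C : f = 0` is a maximal Tjurina curve of type `(d, r)`. -/
def IsMaxTjurina (f : S3) (d r : ℕ) : Prop :=
  IsMDR f r ∧ d ≤ 2 * r ∧
  ∃ τ : ℕ, IsTjurina f τ ∧
    (τ : ℤ) = ((d : ℤ) - 1) ^ 2 - r * ((d : ℤ) - r - 1) - (Nat.choose (2 * r + 2 - d) 2 : ℤ)

/-- `f` is a product of `d` linear forms all vanishing at a common point, i.e.
`C : f = 0` is the union of `d` lines passing through one point. -/
def IsUnionOfConcurrentLines (f : S3) (d : ℕ) : Prop :=
  ∃ (c : ℂ) (L : Fin d → Fin 3 → ℂ) (v : Fin 3 → ℂ), v ≠ 0 ∧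
    f = C c * ∏ j, (∑ i, C (L j i) * X i) ∧ ∀ j, (∑ i, L j i * v i) = 0

/-- The ideal `I_θ` generated by the 2×2 minors of the matrix with rows `(x,y,z)` and
`(a,b,c)`, defining the eigenscheme `Γ_θ` of the derivation `θ = a ∂_x + b ∂_y + c ∂_z`. -/
def eigenIdeal (a b c : S3) : Ideal S3 :=
  Ideal.span {X 1 * c - X 2 * b, X 2 * a - X 0 * c, X 0 * b - X 1 * a}

/-- The projective plane `ℙ²(ℂ)`. -/
abbrev Pt := Projectivization ℂ (Fin 3 → ℂ)

/-- The eigenscheme `Γ_θ` of `θ = a ∂_x + b ∂_y + c ∂_z` is 0-dimensional: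
its set of points in `ℙ²` is finite. -/
def EigenSchemeFinite (a b c : S3) : Prop :=
  {p : Pt | eval p.rep (X 1 * c - X 2 * b) = 0 ∧ eval p.rep (X 2 * a - X 0 * c) = 0 ∧
      eval p.rep (X 0 * b - X 1 * a) = 0}.Finite

section JacobianSyzygies

open Matrix

/-- The gradient of `f`. -/
def gradVec (f : S3) : Fin 3 → S3 := fun i => pderiv i f

lemma mem_jacSyz_iff {f : S3} {v : Fin 3 → S3} : v ∈ jacSyz f ↔ v ⬝ᵥ gradVec f = 0 := by
  change v 0 * pderiv 0 f + v 1 * pderiv 1 f + v 2 * pderiv 2 f = 0 ↔ _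
  simp [dotProduct, Fin.sum_univ_three, gradVec]

/-- A family in a unique factorization domain without common factors can be cancelled from
a divisibility. -/
lemma dvd_of_forall_dvd_mul {R : Type*} [CommRing R] [IsDomain R] [UniqueFactorizationMonoid R]
    {ι : Type*} [Fintype ι] {n : ι → R} (hn : ∀ p, (∀ i, p ∣ n i) → IsUnit p) {F D : R}
    (h : ∀ i, F ∣ D * n i) : F ∣ D := by
  classical
  let _ := UniqueFactorizationMonoid.strongNormalizationMonoid (α := R)
  let _ := UniqueFactorizationMonoid.toNormalizedGCDMonoid R
  have h1 : F ∣ Finset.univ.gcd (fun i => D * n i) := Finset.dvd_gcd fun i _ => h i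
  have h2 : IsUnit (Finset.univ.gcd n) := hn _ fun i => Finset.gcd_dvd (Finset.mem_univ i)
  have h3 := h1.trans (Finset.gcd_mul_left' Finset.univ n D).dvd
  exact (h2.dvd_mul_right).1 h3

lemma exists_eq_smul_of_cross_eq_zero {R : Type*} [CommRing R] [IsDomain R]
    [UniqueFactorizationMonoid R] {n g : Fin 3 → R} (hg : ∀ p, (∀ i, p ∣ g i) → IsUnit p)
    (hg0 : g ≠ 0) (h : n ⨯₃ g = 0) : ∃ k : R, n = k • g := by
  have hp : ∀ i j, n i * g j = n j * g i := by
    rw [cross_apply] at h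
    have h0 := congrFun h 0
    have h1 := congrFun h 1
    have h2 := congrFun h 2
    simp at h0 h1 h2
    intro i j
    fin_cases i <;> fin_cases j <;> simp <;> grind
  obtain ⟨j, hj⟩ := Function.ne_iff.1 hg0
  obtain ⟨k, hk⟩ : g j ∣ n j :=
    dvd_of_forall_dvd_mul hg fun i => ⟨n i, by rw [← hp i j, mul_comm]⟩
  refine ⟨k, funext fun i => mul_right_cancel₀ hj ?_⟩
  rw [hp i j, hk, Pi.smul_apply, smul_eq_mul]
  ring

lemma cross_cross_gradVec {f : S3} {v w : Fin 3 → S3} (hv : v ∈ jacSyz f) (hw : w ∈ jacSyz f) :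
    (v ⨯₃ w) ⨯₃ gradVec f = 0 := by
  rw [mem_jacSyz_iff] at hv hw
  rw [cross_cross_eq_smul_sub_smul, hv, hw]
  simp

lemma X_dotProduct_gradVec {f : S3} {d : ℕ} (hf : f.IsHomogeneous d) :
    (X : Fin 3 → S3) ⬝ᵥ gradVec f = C (d : ℂ) * f := by
  have := hf.sum_X_mul_pderiv
  simpa [dotProduct, gradVec] using this

lemma gradVec_ne_zero {f : S3} {d : ℕ} (hf : f.IsHomogeneous d) (hd : d ≠ 0) (h0 : f ≠ 0) :
    gradVec f ≠ 0 := by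
  intro h
  have := X_dotProduct_gradVec hf
  rw [h, dotProduct_zero] at this
  simp [hd, h0] at this

lemma totalDegree_pderiv_lt {σ R : Type*} [CommSemiring R] {p : MvPolynomial σ R} {i : σ}
    (h : pderiv i p ≠ 0) : (pderiv i p).totalDegree < p.totalDegree := by
  obtain ⟨m, hm, hdeg⟩ := Finset.exists_mem_eq_sup _ (support_nonempty.2 h)
    fun s => s.sum fun _ e => e
  have hm' : m + Finsupp.single i 1 ∈ p.support := by
    rw [mem_support_iff, coeff_pderiv] at hm
    exact mem_support_iff.2 fun h => hm (by simp [h])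
  have := le_totalDegree hm'
  rw [Finsupp.sum_add_index' (by simp) (by simp)] at this
  simp at this
  rw [totalDegree, hdeg]
  exact this

lemma eq_C_of_forall_pderiv_eq_zero {σ R : Type*} [CommRing R] [IsDomain R] [CharZero R]
    {p : MvPolynomial σ R} (h : ∀ i, pderiv i p = 0) : p = C (coeff 0 p) := by
  classical
  ext m
  rw [coeff_C]
  split_ifs with hm
  · rw [hm]
  · obtain ⟨i, hi⟩ := Finsupp.ne_iff.1 (Ne.symm hm)
    have h1 := congrArg (coeff (m - Finsupp.single i 1)) (h i)
    rw [coeff_pderiv, tsub_add_cancel_of_le] at h1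
    · have := Nat.cast_add_one_ne_zero (R := R) (m i - 1)
      simpa [this] using h1
    · simpa using Nat.one_le_iff_ne_zero.2 hi

/-- The partial derivatives of a reduced form have no common factor. -/
lemma isUnit_of_forall_dvd_gradVec {f : S3} {d : ℕ} (hf : f.IsHomogeneous d) (hd : d ≠ 0)
    (hred : Squarefree f) {p : S3} (hp : ∀ i, p ∣ gradVec f i) : IsUnit p := by
  have hpf : p ∣ f := by
    have h1 : p ∣ C (d : ℂ) * f := by
      rw [← X_dotProduct_gradVec hf]
      exact Finset.dvd_sum fun i _ => (hp i).mul_left _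
    have h2 : IsUnit (C (d : ℂ) : S3) := (IsUnit.mk0 (d : ℂ) (by exact_mod_cast hd)).map C
    exact h2.dvd_mul_left.1 h1
  by_contra hu
  obtain ⟨q, hq, hqp⟩ :=
    WfDvdMonoid.exists_irreducible_factor hu (ne_zero_of_dvd_ne_zero hred.ne_zero hpf)
  obtain ⟨g, hg⟩ := hqp.trans hpf
  have hqg : ¬ q ∣ g := fun ⟨k, hk⟩ =>
    hq.not_isUnit (hred q ⟨k, by rw [hg, hk, mul_assoc]⟩)
  have hdiv : ∀ i, pderiv i q = 0 := by
    intro i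
    by_contra hne
    have h1 : q ∣ pderiv i q * g := by
      have := hqp.trans (hp i)
      rw [gradVec, hg, pderiv_mul] at this
      exact (dvd_add_left (dvd_mul_right q _)).1 this
    have h2 := ((hq.prime.dvd_or_dvd h1).resolve_right hqg)
    obtain ⟨k, hk⟩ := h2
    have h3 := totalDegree_pderiv_lt hne
    have hk0 : k ≠ 0 := by rintro rfl; simp [hk] at hne
    rw [hk, totalDegree_mul_of_isDomain hq.ne_zero hk0] at h3
    omega
  have hC := eq_C_of_forall_pderiv_eq_zero hdiv
  refine hq.not_isUnit ?_
  rw [hC]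
  refine (IsUnit.mk0 _ fun h => hq.ne_zero ?_).map C
  rw [hC, h, C_0]

lemma eq_C_of_mul_isHomogeneous {h g : S3} {n : ℕ} (hg : g.IsHomogeneous n) (hg0 : g ≠ 0)
    (hh : (h * g).IsHomogeneous n) : ∃ k : ℂ, h = C k := by
  by_cases h0 : h = 0
  · exact ⟨0, by simp [h0]⟩
  have h1 := hh.totalDegree (mul_ne_zero h0 hg0)
  rw [totalDegree_mul_of_isDomain h0 hg0, hg.totalDegree hg0] at h1
  exact ⟨_, totalDegree_eq_zero_iff_eq_C.1 (by omega)⟩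

lemma cross_isHomogeneous {v w : Fin 3 → S3} {m n : ℕ} (hv : ∀ i, (v i).IsHomogeneous m)
    (hw : ∀ i, (w i).IsHomogeneous n) (i : Fin 3) : ((v ⨯₃ w) i).IsHomogeneous (m + n) := by
  rw [cross_apply]
  fin_cases i <;> exact ((hv _).mul (hw _)).sub ((hv _).mul (hw _))

lemma exists_cross_eq_C_smul_gradVec {f : S3} {d m n : ℕ} (hf : f.IsHomogeneous d)
    (hred : Squarefree f) (hd : m + n + 1 = d) {v w : Fin 3 → S3} (hv : v ∈ jacSyz f)
    (hw : w ∈ jacSyz f) (hvm : ∀ i, (v i).IsHomogeneous m) (hwn : ∀ i, (w i).IsHomogeneous n) :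
    ∃ k : ℂ, v ⨯₃ w = (C k : S3) • gradVec f := by
  have hg0 := gradVec_ne_zero hf (by omega) hred.ne_zero
  obtain ⟨h, hh⟩ := exists_eq_smul_of_cross_eq_zero
    (fun p => isUnit_of_forall_dvd_gradVec hf (by omega) hred) hg0 (cross_cross_gradVec hv hw)
  obtain ⟨j, hj⟩ := Function.ne_iff.1 hg0
  have h1 := cross_isHomogeneous hvm hwn j
  rw [hh, Pi.smul_apply, smul_eq_mul] at h1
  have h2 : (gradVec f j).IsHomogeneous (m + n) := by
    have := hf.pderiv (i := j)
    rwa [show d - 1 = m + n by omega] at this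
  obtain ⟨k, rfl⟩ := eq_C_of_mul_isHomogeneous h2 hj h1
  exact ⟨k, hh⟩

lemma eq_zero_of_cross_eq_zero {R : Type*} [CommRing R] [IsDomain R] {z v w : Fin 3 → R}
    (hv : z ⨯₃ v = 0) (hw : z ⨯₃ w = 0) (hvw : v ⨯₃ w ≠ 0) : z = 0 := by
  have key : ∀ i j, z i * (v ⨯₃ w) j = 0 := by
    have v0 := congrFun hv 0
    have v1 := congrFun hv 1
    have v2 := congrFun hv 2
    have w0 := congrFun hw 0
    have w1 := congrFun hw 1
    have w2 := congrFun hw 2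
    simp [cross_apply] at v0 v1 v2 w0 w1 w2
    intro i j
    fin_cases i <;> fin_cases j <;> simp [cross_apply, -mul_eq_zero] <;> grind
  obtain ⟨j, hj⟩ := Function.ne_iff.1 hvw
  exact funext fun i => (mul_eq_zero.1 (key i j)).resolve_right hj

/-- Saito's criterion for the module of Jacobian syzygies. -/
lemma exists_eq_smul_add_smul {f : S3} {d : ℕ} (hf : f.IsHomogeneous d) (hd : d ≠ 0)
    (hred : Squarefree f) {v w : Fin 3 → S3} (hv : v ∈ jacSyz f) (hw : w ∈ jacSyz f)
    {k : ℂ} (hk : k ≠ 0) (h : v ⨯₃ w = (C k : S3) • gradVec f) {η : Fin 3 → S3} (hη : η ∈ jacSyz f) :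
    ∃ α β : S3, η = α • v + β • w := by
  have hg0 := gradVec_ne_zero hf hd hred.ne_zero
  have hcop : ∀ p, (∀ i, p ∣ gradVec f i) → IsUnit p :=
    fun p => isUnit_of_forall_dvd_gradVec hf hd hred
  obtain ⟨α, hα⟩ := exists_eq_smul_of_cross_eq_zero hcop hg0 (cross_cross_gradVec hη hw)
  obtain ⟨β, hβ⟩ := exists_eq_smul_of_cross_eq_zero hcop hg0 (cross_cross_gradVec hv hη)
  have hkk : (C k⁻¹ * C k : S3) = 1 := by rw [← C_mul, inv_mul_cancel₀ hk, C_1]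
  have hwv : w ⨯₃ v = -((C k : S3) • gradVec f) := by rw [← h, cross_anticomm]
  have hηv : η ⨯₃ v = -(β • gradVec f) := by rw [← hβ, cross_anticomm]
  refine ⟨C k⁻¹ * α, C k⁻¹ * β, sub_eq_zero.1 (eq_zero_of_cross_eq_zero (v := v) (w := w) ?_ ?_ ?_)⟩
  · simp only [map_sub, map_add, map_smul, LinearMap.sub_apply, LinearMap.add_apply,
      LinearMap.smul_apply, cross_self, hwv, hηv]
    ext1 i
    simp only [Pi.sub_apply, Pi.add_apply, Pi.smul_apply, Pi.neg_apply, smul_eq_mul, Pi.zero_apply]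
    linear_combination (β * gradVec f i) * hkk
  · simp only [map_sub, map_add, map_smul, LinearMap.sub_apply, LinearMap.add_apply,
      LinearMap.smul_apply, cross_self, h, hα]
    ext1 i
    simp only [Pi.sub_apply, Pi.add_apply, Pi.smul_apply, smul_eq_mul, Pi.zero_apply]
    linear_combination (-α * gradVec f i) * hkk
  · rw [h]
    intro h0
    exact hg0 ((smul_eq_zero.1 h0).resolve_left (by simpa using hk))

lemma mem_eigenIdeal_iff {a b c p : S3} :
    p ∈ eigenIdeal a b c ↔ ∃ u : Fin 3 → S3, p = u ⬝ᵥ ((X : Fin 3 → S3) ⨯₃ ![a, b, c]) := by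
  rw [eigenIdeal, Ideal.mem_span_insert]
  simp only [Ideal.mem_span_pair, cross_apply, dotProduct, Fin.sum_univ_three]
  constructor
  · rintro ⟨u, _, ⟨v, w, rfl⟩, rfl⟩
    refine ⟨![u, v, w], ?_⟩
    simp
    ring
  · rintro ⟨u, rfl⟩
    refine ⟨u 0, _, ⟨u 1, u 2, rfl⟩, ?_⟩
    simp
    ring

lemma mem_eigenIdeal_of_cross_eq {f a b c : S3} {d : ℕ} (hf : f.IsHomogeneous d) (hd : d ≠ 0)
    {w : Fin 3 → S3} {k : ℂ} (hk : k ≠ 0) (h : ![a, b, c] ⨯₃ w = (C k : S3) • gradVec f) :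
    f ∈ eigenIdeal a b c := by
  refine mem_eigenIdeal_iff.2 ⟨(C (k * d)⁻¹ : S3) • w, ?_⟩
  rw [smul_dotProduct, triple_product_permutation, h, dotProduct_smul, X_dotProduct_gradVec hf,
    smul_eq_mul, smul_eq_mul, ← mul_assoc, ← mul_assoc, mul_assoc (C _), ← C_mul, ← C_mul,
    inv_mul_cancel₀ (mul_ne_zero hk (by exact_mod_cast hd)), C_1, one_mul]

/-- The Koszul syzygies show that `D_0(f)` is not of rank one. -/
lemma exists_cross_ne_zero {f : S3} (hg : gradVec f ≠ 0) :
    ∃ v ∈ jacSyz f, ∃ w ∈ jacSyz f, v ⨯₃ w ≠ 0 := by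
  by_contra! H
  set g := gradVec f with hgdef
  have h0 : ![0, g 2, -g 1] ∈ jacSyz f := by
    rw [mem_jacSyz_iff]; simp [dotProduct, Fin.sum_univ_three, ← hgdef]; ring
  have h1 : ![-g 2, 0, g 0] ∈ jacSyz f := by
    rw [mem_jacSyz_iff]; simp [dotProduct, Fin.sum_univ_three, ← hgdef]; ring
  have h2 : ![g 1, -g 0, 0] ∈ jacSyz f := by
    rw [mem_jacSyz_iff]; simp [dotProduct, Fin.sum_univ_three, ← hgdef]; ring
  have e0 := congrFun (H _ h1 _ h2) 0
  have e1 := congrFun (H _ h2 _ h0) 1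
  have e2 := congrFun (H _ h0 _ h1) 2
  simp [cross_apply] at e0 e1 e2
  refine hg (funext fun i => ?_)
  fin_cases i <;> simp [e0, e1, e2]

theorem mem_eigenIdeal_of_isFreeWith {f : S3} {d r : ℕ} (hf : f.IsHomogeneous d)
    (hred : Squarefree f) {a b c : S3} (hne : ![a, b, c] ≠ 0)
    (hθ : ∀ i, (![a, b, c] i).IsHomogeneous r) (hsyz : ![a, b, c] ∈ jacSyz f)
    (hr : 2 * r + 1 ≤ d) (hfree : IsFreeWith f r (d - r - 1)) : f ∈ eigenIdeal a b c := by
  obtain ⟨v, hv⟩ := hfree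
  have hg0 := gradVec_ne_zero hf (by omega) hred.ne_zero
  have hgen : ∀ η ∈ jacSyz f, ∃ α β : S3, η = α • v 0 + β • v 1 := by
    intro η hη
    rw [← hv.span_eq, Submodule.mem_span_range_iff_exists_fun] at hη
    obtain ⟨k, hk⟩ := hη
    exact ⟨k 0, k 1, by rw [← hk, Fin.sum_univ_two]⟩
  have hv0 : ∀ i, (v 0 i).IsHomogeneous r := hv.hom 0
  have hv1 : ∀ i, (v 1 i).IsHomogeneous (d - r - 1) := hv.hom 1
  have hv01 : v 0 ⨯₃ v 1 ≠ 0 := by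
    intro h0
    obtain ⟨p, hp, q, hq, hpq⟩ := exists_cross_ne_zero hg0
    obtain ⟨α, β, rfl⟩ := hgen p hp
    obtain ⟨γ, δ, rfl⟩ := hgen q hq
    have h1 : v 1 ⨯₃ v 0 = 0 := by rw [← cross_anticomm, h0, neg_zero]
    simp [h0, h1] at hpq
  obtain ⟨α, β, hαβ⟩ := hgen _ hsyz
  have hc1 : ![a, b, c] ⨯₃ v 1 = α • (v 0 ⨯₃ v 1) := by simp [hαβ]
  obtain ⟨k, hk⟩ := exists_cross_eq_C_smul_gradVec hf hred
    (by omega : r + (d - r - 1) + 1 = d) hsyz (hv.mem 1) hθ hv1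
  by_cases hk0 : k = 0
  · have hα : α = 0 := by
      rw [hk, hk0, C_0, zero_smul] at hc1
      exact (smul_eq_zero.1 hc1.symm).resolve_right hv01
    rw [hα, zero_smul, zero_add] at hαβ
    have hβ : β ≠ 0 := by rintro rfl; exact hne (by rw [hαβ, zero_smul])
    have hdeg : d - r - 1 ≤ r := by
      obtain ⟨i, hi⟩ := Function.ne_iff.1 hne
      have h1 := (hθ i).totalDegree hi
      have h2 : v 1 i ≠ 0 := by
        intro h
        rw [hαβ, Pi.smul_apply, h, smul_zero] at hi
        exact hi rfl
      rw [hαβ, Pi.smul_apply, smul_eq_mul, totalDegree_mul_of_isDomain hβ h2,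
        (hv1 i).totalDegree h2] at h1
      omega
    obtain ⟨l, hl⟩ := exists_cross_eq_C_smul_gradVec hf hred (by omega) hsyz (hv.mem 0) hθ hv0
    refine mem_eigenIdeal_of_cross_eq hf (by omega) (w := v 0) (k := l) ?_ hl
    rintro rfl
    have h1 : ![a, b, c] ⨯₃ v 0 = -(β • (v 0 ⨯₃ v 1)) := by
      rw [hαβ, ← cross_anticomm, map_smul]
    rw [hl, C_0, zero_smul, eq_comm, neg_eq_zero] at h1
    exact (smul_ne_zero hβ hv01) h1
  · exact mem_eigenIdeal_of_cross_eq hf (by omega) hk0 hk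

lemma homogeneousComponent_mul_of_isHomogeneous {p q : S3} {m : ℕ} (hp : p.IsHomogeneous m)
    (n : ℕ) : homogeneousComponent n (p * q) =
      if m ≤ n then p * homogeneousComponent (n - m) q else 0 := by
  classical
  let _ := gradedAlgebra (σ := Fin 3) (R := ℂ)
  have h := DirectSum.coe_decompose_mul_of_left_mem (homogeneousSubmodule (Fin 3) ℂ) n
    (b := q) ((mem_homogeneousSubmodule m p).2 hp)
  have hd : ∀ (φ : S3) (i : ℕ), (DirectSum.decompose (homogeneousSubmodule (Fin 3) ℂ) φ i : S3) =
      homogeneousComponent i φ := decomposition.decompose'_apply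
  simpa only [hd] using h

/-- Substituting `X i ↦ X i * t` in `p`; the coefficients in `t` are the homogeneous components. -/
def scaleVars : S3 →ₐ[ℂ] Polynomial S3 := aeval fun i => Polynomial.C (X i) * Polynomial.X

lemma scaleVars_of_isHomogeneous {p : S3} {n : ℕ} (hp : p.IsHomogeneous n) :
    scaleVars p = Polynomial.C p * Polynomial.X ^ n := by
  have hmon : ∀ s : Fin 3 →₀ ℕ, scaleVars (monomial s (coeff s p)) =
      Polynomial.C (monomial s (coeff s p)) * Polynomial.X ^ n := by
    intro s
    by_cases hs : coeff s p = 0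
    · simp [hs]
    have hdeg : s.degree = n := by
      by_contra h
      exact hs (hp.coeff_eq_zero h)
    have hprod : (s.prod fun i j => (Polynomial.C (X i : S3) * Polynomial.X) ^ j) =
        Polynomial.C (s.prod fun i j => (X i : S3) ^ j) * Polynomial.X ^ n := by
      rw [← hdeg, Finsupp.degree_apply, Finsupp.prod, Finsupp.prod, map_prod,
        ← Finset.prod_pow_eq_pow_sum, ← Finset.prod_mul_distrib]
      exact Finset.prod_congr rfl fun i _ => by rw [mul_pow, map_pow]
    rw [scaleVars, aeval_monomial, monomial_eq, hprod, Polynomial.algebraMap_apply,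
      MvPolynomial.algebraMap_eq, map_mul, mul_assoc]
  conv_lhs => rw [p.as_sum]
  conv_rhs => rw [p.as_sum]
  simp only [map_sum, Finset.sum_mul, hmon]

lemma coeff_scaleVars (p : S3) (n : ℕ) : (scaleVars p).coeff n = homogeneousComponent n p := by
  conv_lhs => rw [← sum_homogeneousComponent p]
  rw [map_sum, Polynomial.finsetSum_coeff]
  simp only [scaleVars_of_isHomogeneous (homogeneousComponent_isHomogeneous _ p),
    Polynomial.coeff_C_mul, Polynomial.coeff_X_pow, mul_ite, mul_one, mul_zero]
  rw [Finset.sum_ite_eq]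
  split_ifs with h
  · rfl
  · exact (homogeneousComponent_eq_zero _ _ (by simpa [Nat.lt_succ_iff] using h)).symm

lemma scaleVars_injective : Function.Injective scaleVars := by
  intro p q h
  rw [← sum_homogeneousComponent p, ← sum_homogeneousComponent q]
  have hc : ∀ n, homogeneousComponent n p = homogeneousComponent n q := fun n => by
    rw [← coeff_scaleVars, ← coeff_scaleVars, h]
  ext s
  rw [sum_homogeneousComponent, sum_homogeneousComponent]
  have := congrArg (coeff s) (hc s.degree)
  simpa [coeff_homogeneousComponent] using this

/-- A common factor of forms has a nonconstant leading form dividing all of them. -/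
lemma exists_isHomogeneous_dvd {ι : Type*} {n : ι → S3} {e : ℕ}
    (hn : ∀ i, (n i).IsHomogeneous e) {p : S3} (hp0 : p ≠ 0) (hpu : ¬ IsUnit p)
    (hp : ∀ i, p ∣ n i) :
    ∃ (P : S3) (k : ℕ), P.IsHomogeneous k ∧ P ≠ 0 ∧ k ≠ 0 ∧ ∀ i, P ∣ n i := by
  have hs0 : scaleVars p ≠ 0 := fun h => hp0 (scaleVars_injective (by rw [h, map_zero]))
  refine ⟨(scaleVars p).leadingCoeff, (scaleVars p).natDegree, ?_, ?_, ?_, fun i => ?_⟩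
  · rw [Polynomial.leadingCoeff, coeff_scaleVars]
    exact homogeneousComponent_isHomogeneous _ _
  · exact Polynomial.leadingCoeff_ne_zero.2 hs0
  · intro h0
    have hC : p = C (coeff 0 p) := by
      apply scaleVars_injective
      rw [Polynomial.eq_C_of_natDegree_eq_zero h0, coeff_scaleVars, homogeneousComponent_zero,
        scaleVars_of_isHomogeneous (isHomogeneous_C _ _), pow_zero, mul_one]
    refine hpu ?_
    rw [hC]
    refine (IsUnit.mk0 _ fun h => hp0 ?_).map C
    rw [hC, h, C_0]
  · obtain ⟨q, hq⟩ := hp i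
    have h1 := congrArg (fun s => (scaleVars s).leadingCoeff) hq
    simp only [map_mul, Polynomial.leadingCoeff_mul] at h1
    rw [scaleVars_of_isHomogeneous (hn i)] at h1
    simp at h1
    exact ⟨_, h1⟩

/-- The restriction of `p` to the line `t ↦ u + t v`. -/
def restrictLine (u v : Fin 3 → ℂ) : S3 →ₐ[ℂ] Polynomial ℂ :=
  aeval fun i => Polynomial.C (u i) + Polynomial.C (v i) * Polynomial.X

lemma eval_restrictLine (u v : Fin 3 → ℂ) (p : S3) (t : ℂ) :
    (restrictLine u v p).eval t = eval (u + t • v) p := by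
  rw [restrictLine, ← Polynomial.coe_aeval_eq_eval, ← AlgHom.comp_apply, comp_aeval,
    aeval_eq_eval]
  congr 2
  ext i
  simp
  ring

lemma eval_smul_of_isHomogeneous {p : S3} {k : ℕ} (hp : p.IsHomogeneous k) (t : ℂ)
    (v : Fin 3 → ℂ) : eval (t • v) p = t ^ k * eval v p := by
  rw [eval_eq, eval_eq, Finset.mul_sum]
  refine Finset.sum_congr rfl fun s hs => ?_
  have hdeg : ∑ i ∈ s.support, s i = k := by
    rw [← Finsupp.degree_apply]
    by_contra h
    exact mem_support_iff.1 hs (hp.coeff_eq_zero h)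
  simp only [Pi.smul_apply, smul_eq_mul, mul_pow]
  rw [Finset.prod_mul_distrib, Finset.prod_pow_eq_pow_sum, hdeg]
  ring

/-- Every line through a point off a plane curve meets the curve. -/
lemma exists_eval_add_smul_eq_zero {P : S3} {k : ℕ} (hP : P.IsHomogeneous k) (hk : k ≠ 0)
    {q : Fin 3 → ℂ} (hq : eval q P ≠ 0) (u : Fin 3 → ℂ) : ∃ t : ℂ, eval (u + t • q) P = 0 := by
  by_contra! H
  have hdeg : (restrictLine u q P).degree = 0 := by
    by_contra hd
    obtain ⟨t, ht⟩ := IsAlgClosed.exists_root _ hd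
    exact H t (by rw [← eval_restrictLine]; exact ht)
  obtain ⟨κ, hκ⟩ : ∃ κ, restrictLine u q P = Polynomial.C κ :=
    ⟨_, Polynomial.eq_C_of_degree_eq_zero hdeg⟩
  have hconst : ∀ t : ℂ, eval (u + t • q) P = κ := fun t => by
    rw [← eval_restrictLine, hκ, Polynomial.eval_C]
  have hrev : restrictLine q u P = Polynomial.C κ * Polynomial.X ^ k := by
    refine Polynomial.eq_of_infinite_eval_eq _ _
      ((Set.finite_singleton (0 : ℂ)).infinite_compl.mono fun t ht => ?_)
    have ht : t ≠ 0 := ht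
    have h1 : q + t • u = t • (u + t⁻¹ • q) := by
      rw [smul_add, smul_inv_smul₀ ht, add_comm]
    change Polynomial.eval t _ = Polynomial.eval t _
    rw [eval_restrictLine, h1, eval_smul_of_isHomogeneous hP, hconst]
    simp
    ring
  have h0 := eval_restrictLine q u P 0
  rw [hrev] at h0
  simp [hk] at h0
  exact hq h0.symm

/-- A plane curve has infinitely many points. -/
lemma infinite_zeros_of_isHomogeneous {P : S3} {k : ℕ} (hP : P.IsHomogeneous k) (hP0 : P ≠ 0)
    (hk : k ≠ 0) : {p : Pt | eval p.rep P = 0}.Infinite := by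
  obtain ⟨q, hq⟩ : ∃ q : Fin 3 → ℂ, eval q P ≠ 0 := by
    by_contra! H
    exact hP0 (MvPolynomial.funext fun x => by rw [H x, map_zero])
  have hq0 : q ≠ 0 := by
    rintro rfl
    have := eval_smul_of_isHomogeneous hP 0 0
    rw [smul_zero, zero_pow hk, zero_mul] at this
    exact hq this
  obtain ⟨i, hi⟩ := Function.ne_iff.1 hq0
  simp only [Pi.zero_apply] at hi
  let u : ℂ → Fin 3 → ℂ := fun t => Pi.single (i + 1) 1 + t • Pi.single (i + 2) 1
  have hex : ∀ t, ∃ s : ℂ, eval (u t + s • q) P = 0 := fun t =>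
    exists_eval_add_smul_eq_zero hP hk hq (u t)
  choose s hs using hex
  have h1 : i + 1 ≠ i := by fin_cases i <;> decide
  have h2 : i + 2 ≠ i := by fin_cases i <;> decide
  have h3 : i + 1 ≠ i + 2 := by fin_cases i <;> decide
  have ui : ∀ t, (u t + s t • q) i = s t * q i := fun t => by
    simp [u, h1.symm, h2.symm]
  have uj : ∀ t, (u t + s t • q) (i + 1) = 1 + s t * q (i + 1) := fun t => by
    simp [u, h3]
  have ul : ∀ t, (u t + s t • q) (i + 2) = t + s t * q (i + 2) := fun t => by
    simp [u, h3.symm]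
  have hne : ∀ t, u t + s t • q ≠ 0 := by
    intro t h
    have e1 := ui t
    have e2 := uj t
    rw [h] at e1 e2
    have hst : s t = 0 := by simpa [hi] using e1.symm
    simp [hst] at e2
  refine Set.infinite_of_injective_forall_mem
    (f := fun t : ℂ => Projectivization.mk ℂ (u t + s t • q) (hne t)) ?_ fun t => ?_
  · intro t t' h
    obtain ⟨l, hl⟩ := (Projectivization.mk_eq_mk_iff' ℂ _ _ _ _).1 h
    have e1 := congrFun hl i
    have e2 := congrFun hl (i + 1)
    have e3 := congrFun hl (i + 2)
    rw [Pi.smul_apply, ui, ui, smul_eq_mul] at e1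
    rw [Pi.smul_apply, uj, uj, smul_eq_mul] at e2
    rw [Pi.smul_apply, ul, ul, smul_eq_mul] at e3
    have e1' : l * s t' = s t := mul_right_cancel₀ hi (by linear_combination e1)
    have hl1 : l = 1 := by linear_combination e2 - q (i + 1) * e1'
    rw [hl1, one_mul] at e1' e3
    linear_combination -e3 + q (i + 2) * e1'
  · obtain ⟨l, hl⟩ := Projectivization.exists_smul_eq_mk_rep ℂ (u t + s t • q) (hne t)
    change eval (Projectivization.rep _) P = 0
    rw [← hl, Units.smul_def, eval_smul_of_isHomogeneous hP, hs, mul_zero]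

lemma isUnit_of_forall_dvd_minors {a b c : S3} {r : ℕ}
    (hθ : ∀ i, (![a, b, c] i).IsHomogeneous r) (hΓ : EigenSchemeFinite a b c) {p : S3}
    (hp : ∀ i, p ∣ ((X : Fin 3 → S3) ⨯₃ ![a, b, c]) i) : IsUnit p := by
  have hfin : ∀ (P : S3) (k : ℕ), P.IsHomogeneous k → P ≠ 0 → k ≠ 0 →
      ¬ ∀ i, P ∣ ((X : Fin 3 → S3) ⨯₃ ![a, b, c]) i := by
    intro P k hP hP0 hk hdvd
    refine infinite_zeros_of_isHomogeneous hP hP0 hk (hΓ.subset fun x hx => ?_)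
    have hev : ∀ i, eval x.rep (((X : Fin 3 → S3) ⨯₃ ![a, b, c]) i) = 0 := by
      intro i
      obtain ⟨m, hm⟩ := hdvd i
      rw [hm, map_mul, show eval x.rep P = 0 from hx, zero_mul]
    have e0 := hev 0
    have e1 := hev 1
    have e2 := hev 2
    simp only [cross_apply] at e0 e1 e2
    exact ⟨e0, e1, e2⟩
  by_contra hu
  by_cases hp0 : p = 0
  · subst hp0
    exact hfin (X 0) 1 (isHomogeneous_X _ _) (X_ne_zero _) one_ne_zero fun i => by
      rw [zero_dvd_iff.1 (hp i)]
      exact dvd_zero _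
  · obtain ⟨P, k, hP, hP0, hk, hdvd⟩ :=
      exists_isHomogeneous_dvd (cross_isHomogeneous (fun i => isHomogeneous_X ℂ i) hθ) hp0 hu hp
    exact hfin P k hP hP0 hk hdvd

lemma triple_product_smul {R : Type*} [CommRing R] (u v w g : Fin 3 → R) :
    (u ⬝ᵥ v ⨯₃ w) • g =
      (u ⬝ᵥ g) • (v ⨯₃ w) + (v ⬝ᵥ g) • (w ⨯₃ u) + (w ⬝ᵥ g) • (u ⨯₃ v) := by
  ext i
  fin_cases i <;> simp [cross_apply, dotProduct, Fin.sum_univ_three] <;> ring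

lemma exists_isHomogeneous_dotProduct {m : Fin 3 → S3} {f : S3} {d k : ℕ} (hkd : k ≤ d)
    (hm : ∀ i, (m i).IsHomogeneous k) (hf : f.IsHomogeneous d) {u : Fin 3 → S3}
    (hu : f = u ⬝ᵥ m) : ∃ u' : Fin 3 → S3, (∀ i, (u' i).IsHomogeneous (d - k)) ∧ f = u' ⬝ᵥ m := by
  refine ⟨fun i => homogeneousComponent (d - k) (u i),
    fun i => homogeneousComponent_isHomogeneous _ _, ?_⟩
  have h1 := homogeneousComponent_eq_self hf
  rw [← h1]
  conv_lhs => rw [hu]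
  simp only [dotProduct, map_sum]
  refine Finset.sum_congr rfl fun i _ => ?_
  rw [mul_comm, homogeneousComponent_mul_of_isHomogeneous (hm i), if_pos hkd, mul_comm]

/-- The quotient of a form of degree `d - 1 + e` by a form of degree `d` can be chosen
to be a form, of degree `e - 1`. -/
lemma exists_isHomogeneous_X_mul_of_dvd {f g : S3} {d e : ℕ} (hf : f.IsHomogeneous d)
    (hg : g.IsHomogeneous (d - 1 + e)) (hd : d ≠ 0) (h : f ∣ g) :
    ∃ q : S3, g = f * q ∧ ∀ i, (X i * q).IsHomogeneous e := by
  obtain ⟨q, hq⟩ := h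
  have h1 : g = homogeneousComponent (d - 1 + e) (f * q) := by
    rw [← hq, homogeneousComponent_eq_self hg]
  rw [homogeneousComponent_mul_of_isHomogeneous hf] at h1
  split_ifs at h1 with hle
  · refine ⟨_, h1, fun i => ?_⟩
    have := (isHomogeneous_X ℂ i).mul (homogeneousComponent_isHomogeneous (d - 1 + e - d) q)
    rwa [show 1 + (d - 1 + e - d) = e by omega] at this
  · exact ⟨0, by rw [h1, mul_zero], fun i => by rw [mul_zero]; exact isHomogeneous_zero _ _ _⟩

lemma isMinGenSyz_pair {f : S3} {d r e : ℕ} (hf : f.IsHomogeneous d) (hd : d ≠ 0)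
    (hred : Squarefree f) (hre : r ≤ e) {v w : Fin 3 → S3} (hv : v ∈ jacSyz f)
    (hw : w ∈ jacSyz f) (hvr : ∀ i, (v i).IsHomogeneous r) (hwe : ∀ i, (w i).IsHomogeneous e)
    {k : ℂ} (hk : k ≠ 0) (h : v ⨯₃ w = (C k : S3) • gradVec f) :
    IsMinGenSyz f 2 ![r, e] ![v, w] := by
  have hvw : v ⨯₃ w ≠ 0 := by
    rw [h]
    exact smul_ne_zero (by simpa using hk) (gradVec_ne_zero hf hd hred.ne_zero)
  have hmem : ∀ j, ![v, w] j ∈ jacSyz f := by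
    intro j
    fin_cases j
    exacts [hv, hw]
  refine ⟨hmem, ?_, ?_, ?_, ?_, ?_⟩
  · intro j
    fin_cases j
    exacts [hvr, hwe]
  · intro j h0
    refine hvw ?_
    fin_cases j
    · rw [show v = 0 from h0]; simp
    · rw [show w = 0 from h0]; simp
  · refine le_antisymm (Submodule.span_le.2 (Set.range_subset_iff.2 hmem)) fun η hη => ?_
    obtain ⟨α, β, hαβ⟩ := exists_eq_smul_add_smul hf hd hred hv hw hk h hη
    rw [Submodule.mem_span_range_iff_exists_fun]
    exact ⟨![α, β], by rw [hαβ, Fin.sum_univ_two]; rfl⟩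
  · intro j hj
    refine hvw ?_
    fin_cases j
    · have hset : {j' : Fin 2 | j' ≠ 0} = {1} := by ext j'; fin_cases j' <;> simp
      change v ∈ Submodule.span S3 (![v, w] '' {j' | j' ≠ 0}) at hj
      rw [hset, Set.image_singleton, Submodule.mem_span_singleton] at hj
      obtain ⟨α, hα⟩ := hj
      rw [← hα]
      simp
    · have hset : {j' : Fin 2 | j' ≠ 1} = {0} := by ext j'; fin_cases j' <;> simp
      change w ∈ Submodule.span S3 (![v, w] '' {j' | j' ≠ 1}) at hj
      rw [hset, Set.image_singleton, Submodule.mem_span_singleton] at hj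
      obtain ⟨α, hα⟩ := hj
      rw [← hα]
      simp
  · intro i j hij
    fin_cases i <;> fin_cases j <;> simp_all

theorem isFreeWith_of_mem_eigenIdeal {f : S3} {d r : ℕ} (hf : f.IsHomogeneous d)
    (hred : Squarefree f) {a b c : S3} (hθ : ∀ i, (![a, b, c] i).IsHomogeneous r)
    (hsyz : ![a, b, c] ∈ jacSyz f) (hr : 2 * r + 1 ≤ d) (hΓ : EigenSchemeFinite a b c)
    (hmem : f ∈ eigenIdeal a b c) : IsFreeWith f r (d - r - 1) := by
  have hd : d ≠ 0 := by omega
  have hdC : (d : ℂ) ≠ 0 := by exact_mod_cast hd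
  have hm := cross_isHomogeneous (fun i => isHomogeneous_X ℂ i) hθ
  obtain ⟨u₀, hu₀⟩ := mem_eigenIdeal_iff.1 hmem
  obtain ⟨u, hue, hu⟩ := exists_isHomogeneous_dotProduct (by omega) hm hf hu₀
  rw [show d - (1 + r) = d - r - 1 by omega] at hue
  have hθg := mem_jacSyz_iff.1 hsyz
  have hdvd : f ∣ u ⬝ᵥ gradVec f := by
    refine dvd_of_forall_dvd_mul (fun p => isUnit_of_forall_dvd_minors hθ hΓ) fun i => ?_
    have h := congrFun (triple_product_smul u X ![a, b, c] (gradVec f)) i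
    rw [← hu, hθg, X_dotProduct_gradVec hf] at h
    simp only [zero_smul, Pi.add_apply, Pi.smul_apply, smul_eq_mul, Pi.zero_apply] at h
    exact ⟨gradVec f i - C (d : ℂ) * (![a, b, c] ⨯₃ u) i, by linear_combination -h⟩
  have hug : (u ⬝ᵥ gradVec f).IsHomogeneous (d - 1 + (d - r - 1)) := by
    refine IsHomogeneous.sum _ _ _ fun i _ => ?_
    rw [add_comm]
    exact (hue i).mul hf.pderiv
  obtain ⟨q, hq, hqX⟩ := exists_isHomogeneous_X_mul_of_dvd hf hug hd hdvd
  have hdd : (C (d : ℂ)⁻¹ * C (d : ℂ) : S3) = 1 := by rw [← C_mul, inv_mul_cancel₀ hdC, C_1]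
  let w : Fin 3 → S3 := u - (C (d : ℂ)⁻¹ * q) • (X : Fin 3 → S3)
  have hw : w ∈ jacSyz f := by
    rw [mem_jacSyz_iff, sub_dotProduct, smul_dotProduct, hq, X_dotProduct_gradVec hf, smul_eq_mul]
    linear_combination (-(q * f)) * hdd
  have hwe : ∀ i, (w i).IsHomogeneous (d - r - 1) := by
    intro i
    have : w i = u i - C (d : ℂ)⁻¹ * (X i * q) := by
      simp only [w, Pi.sub_apply, Pi.smul_apply, smul_eq_mul]
      ring
    rw [this]
    exact (hue i).sub ((hqX i).C_mul _)
  obtain ⟨k, hk⟩ := exists_cross_eq_C_smul_gradVec hf hred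
    (by omega : r + (d - r - 1) + 1 = d) hsyz hw hθ hwe
  refine ⟨![![a, b, c], w], isMinGenSyz_pair hf hd hred (by omega) hsyz hw hθ hwe ?_ hk⟩
  rintro rfl
  refine hred.ne_zero ?_
  have h1 : w ⬝ᵥ (X : Fin 3 → S3) ⨯₃ ![a, b, c] = f := by
    rw [sub_dotProduct, smul_dotProduct, dot_self_cross, smul_zero, sub_zero, ← hu]
  rw [← h1, triple_product_permutation, hk, C_0, zero_smul, dotProduct_zero]

end JacobianSyzygies

/-- (Di Gennaro–Ilardi–Miró-Roig–Schenck–Vallès) Let `C : f = 0` be a reduced plane curve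
of degree `d` and let `θ = a ∂_x + b ∂_y + c ∂_z ∈ D_0(f)` be a nonzero derivation of
degree `r` with `2r ≤ d - 1`, whose eigenscheme `Γ_θ` is 0-dimensional. Then `C` is free
with exponents `(r, d - r - 1)` if and only if `f ∈ I_θ`. -/
theorem statement14 (f : S3) (d r : ℕ) (hhom : f.IsHomogeneous d) (hred : Squarefree f)
    (a b c : S3) (hne : ¬ (a = 0 ∧ b = 0 ∧ c = 0))
    (ha : a.IsHomogeneous r) (hb : b.IsHomogeneous r) (hc : c.IsHomogeneous r)
    (hsyz : a * pderiv 0 f + b * pderiv 1 f + c * pderiv 2 f = 0)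
    (hr : 2 * r + 1 ≤ d) (hΓ : EigenSchemeFinite a b c) :
    IsFreeWith f r (d - r - 1) ↔ f ∈ eigenIdeal a b c := by
  have hθ : ∀ i, (![a, b, c] i).IsHomogeneous r := by
    intro i
    fin_cases i
    exacts [ha, hb, hc]
  have hne' : ![a, b, c] ≠ 0 := fun h => hne ⟨congrFun h 0, congrFun h 1, congrFun h 2⟩
  exact ⟨mem_eigenIdeal_of_isFreeWith hhom hred hne' hθ hsyz hr,
    isFreeWith_of_mem_eigenIdeal hhom hred hθ hsyz hr hΓ⟩

end
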